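/- arXiv:2106.04827 — 6 statements merged into one kernel-verified Lean document; each statement's English description precedes it below -/
import Mathlib

section
/- Let C be an (n+1)×m real matrix encoding a hypergraph with real coefficients G on n+1 vertices, let v be a vertex, and let C' be the n×m matrix obtained from C by deleting row v (encoding the hypergraph G∖v obtained by deleting the vertex v). Let A(G) and A(G∖v) be the adjacency matrices of C and C' respectively. Then for every k ∈ {1,…,n}: λ_k(A(G)) ≤ λ_k(A(G∖v)) ≤ λ_{k+1}(A(G)). -/
/-- The degree of vertex `i` in the hypergraph with real coefficients encoded by
the incidence matrix `C`: `deg i = ∑ e, (C i e)^2`. -/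
noncomputable def hypDeg {n : ℕ} {E : Type*} [Fintype E] (C : Matrix (Fin n) E ℝ) (i : Fin n) :
    ℝ :=
  ∑ e, (C i e) ^ 2

/-- The adjacency matrix of the hypergraph with real coefficients encoded by `C`:
zero on the diagonal and `A i j = -∑ e, C i e * C j e` off the diagonal. -/
noncomputable def hypAdj {n : ℕ} {E : Type*} [Fintype E] (C : Matrix (Fin n) E ℝ) :
    Matrix (Fin n) (Fin n) ℝ :=
  Matrix.of fun i j => if i = j then 0 else -∑ e, C i e * C j e

/-- The normalized Laplacian `L = I - D^{-1/2} A D^{-1/2}`. -/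
noncomputable def hypNormLap {n : ℕ} {E : Type*} [Fintype E] (C : Matrix (Fin n) E ℝ) :
    Matrix (Fin n) (Fin n) ℝ :=
  1 - Matrix.diagonal (fun i => (Real.sqrt (hypDeg C i))⁻¹) * hypAdj C *
      Matrix.diagonal (fun i => (Real.sqrt (hypDeg C i))⁻¹)

open Classical in
/-- The eigenvalues of a real symmetric matrix, listed in nondecreasing order with
multiplicity; `sortedEig A k` is the `(k+1)`-st smallest eigenvalue (0-indexed).
(Junk value `0` if `A` is not symmetric.) -/
noncomputable def sortedEig {n : ℕ} (A : Matrix (Fin n) (Fin n) ℝ) : Fin n → ℝ :=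
  if hA : A.IsHermitian then hA.eigenvalues ∘ Tuple.sort hA.eigenvalues else 0


lemma aux_sorted {N : ℕ} (A : Matrix (Fin N) (Fin N) ℝ) (hA : A.IsHermitian) :
    Monotone (sortedEig A) ∧ ∃ c : (Fin N → ℝ) →ₗ[ℝ] (Fin N → ℝ), 
      (∀ x, x ⬝ᵥ x = ∑ i, (c x i) ^ 2) ∧
      (∀ x, x ⬝ᵥ (A.mulVec x) = ∑ i, sortedEig A i * (c x i) ^ 2) := by
  have hs : sortedEig A = hA.eigenvalues ∘ Tuple.sort hA.eigenvalues := by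
    rw [sortedEig, dif_pos hA]
  refine ⟨by rw [hs]; exact Tuple.monotone_sort _, ?_⟩
  set U : Matrix (Fin N) (Fin N) ℝ := (hA.eigenvectorUnitary : Matrix (Fin N) (Fin N) ℝ) with hU
  have hUU : U * U.transpose = 1 := by
    have := Unitary.coe_mul_star_self hA.eigenvectorUnitary
    simpa [Matrix.star_eq_conjTranspose] using this
  have hsp : A = U * Matrix.diagonal hA.eigenvalues * U.transpose := by
    have := hA.spectral_theorem
    rw [Unitary.conjStarAlgAut_apply] at this
    simpa [Matrix.star_eq_conjTranspose, Function.comp_def] using this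
  refine ⟨(LinearMap.funLeft ℝ ℝ (Tuple.sort hA.eigenvalues)).comp U.transpose.mulVecLin, ?_, ?_⟩
  · intro x
    have h1 : x ⬝ᵥ x = U.transpose.mulVec x ⬝ᵥ U.transpose.mulVec x := by
      rw [Matrix.dotProduct_mulVec, Matrix.vecMul_transpose, Matrix.mulVec_mulVec, hUU,
        Matrix.one_mulVec]
    rw [h1]
    simp only [LinearMap.comp_apply, LinearMap.funLeft_apply, Matrix.mulVecLin_apply]
    rw [Equiv.sum_comp (Tuple.sort hA.eigenvalues) (fun i => (U.transpose.mulVec x i) ^ 2)]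
    simp [dotProduct, sq]
  · intro x
    have h1 : x ⬝ᵥ A.mulVec x = U.transpose.mulVec x ⬝ᵥ
        (Matrix.diagonal hA.eigenvalues).mulVec (U.transpose.mulVec x) := by
      conv_lhs => rw [hsp]
      rw [← Matrix.mulVec_mulVec, ← Matrix.mulVec_mulVec, Matrix.dotProduct_mulVec x U,
        Matrix.mulVec_transpose]
    rw [h1, hs]
    simp only [LinearMap.comp_apply, LinearMap.funLeft_apply, Matrix.mulVecLin_apply,
      Function.comp]
    rw [Equiv.sum_comp (Tuple.sort hA.eigenvalues)
      (fun i => hA.eigenvalues i * (U.transpose.mulVec x i) ^ 2)]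
    simp only [dotProduct, Matrix.mulVec_diagonal]
    exact Finset.sum_congr rfl fun i _ => by ring

lemma aux_ker {n p q : ℕ} (f : (Fin n → ℝ) →ₗ[ℝ] (Fin p → ℝ)) (g : (Fin n → ℝ) →ₗ[ℝ] (Fin q → ℝ))
    (S : Finset (Fin p)) (T : Finset (Fin q)) (h : S.card + T.card < n) :
    ∃ y, y ≠ 0 ∧ (∀ i ∈ S, f y i = 0) ∧ (∀ i ∈ T, g y i = 0) := by
  let F : (Fin n → ℝ) →ₗ[ℝ] ((S → ℝ) × (T → ℝ)) :=
    ((LinearMap.funLeft ℝ ℝ (fun i : S => (i : Fin p))).comp f).prod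
      ((LinearMap.funLeft ℝ ℝ (fun i : T => (i : Fin q))).comp g)
  have hk : LinearMap.ker F ≠ ⊥ := LinearMap.ker_ne_bot_of_finrank_lt (by simpa using h)
  obtain ⟨y, hy, hy0⟩ := (Submodule.ne_bot_iff _).1 hk
  have hy' : F y = 0 := hy
  refine ⟨y, hy0, fun i hi => ?_, fun i hi => ?_⟩
  · exact congrFun (congrArg Prod.fst hy') ⟨i, hi⟩
  · exact congrFun (congrArg Prod.snd hy') ⟨i, hi⟩

lemma hypAdj_herm {n : ℕ} {E : Type*} [Fintype E] (C : Matrix (Fin n) E ℝ) :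
    (hypAdj C).IsHermitian := by
  ext i j
  simp [hypAdj, eq_comm, mul_comm]

/-- Interlacing for the adjacency matrix under vertex deletion. -/
theorem adj_interlacing_vertex {n m : ℕ} (C : Matrix (Fin (n + 1)) (Fin m) ℝ)
    (v : Fin (n + 1)) (k : Fin n) :
    sortedEig (hypAdj C) k.castSucc ≤ sortedEig (hypAdj (C.submatrix v.succAbove id)) k ∧
    sortedEig (hypAdj (C.submatrix v.succAbove id)) k ≤ sortedEig (hypAdj C) k.succ := by
  obtain ⟨hm, c, hc1, hc2⟩ := aux_sorted _ (hypAdj_herm C)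
  obtain ⟨hm', c', hc1', hc2'⟩ := aux_sorted _ (hypAdj_herm (C.submatrix v.succAbove id))
  let P : (Fin n → ℝ) →ₗ[ℝ] (Fin (n + 1) → ℝ) :=
    { toFun := fun y => v.insertNth (α := fun _ => ℝ) 0 y
      map_add' := fun x y => by
        ext i
        refine Fin.succAboveCases v ?_ (fun j => ?_) i <;> simp
      map_smul' := fun a y => by
        ext i
        refine Fin.succAboveCases v ?_ (fun j => ?_) i <;> simp }
  have hPv : ∀ y, P y v = 0 := fun y => by simp [P]
  have hPs : ∀ y j, P y (v.succAbove j) = y j := fun y j => by simp [P]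
  have hP1 : ∀ y, P y ⬝ᵥ P y = y ⬝ᵥ y := fun y => by
    simp [dotProduct, Fin.sum_univ_succAbove _ v, hPv, hPs]
  have hP2 : ∀ y, P y ⬝ᵥ (hypAdj C).mulVec (P y) =
      y ⬝ᵥ (hypAdj (C.submatrix v.succAbove id)).mulVec y := fun y => by
    simp [dotProduct, Matrix.mulVec, Fin.sum_univ_succAbove _ v, hPv, hPs, hypAdj]
  have hpos : ∀ y : Fin n → ℝ, y ≠ 0 → 0 < y ⬝ᵥ y := fun y hy => by
    have h0 : 0 ≤ y ⬝ᵥ y := Finset.sum_nonneg fun i _ => mul_self_nonneg _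
    exact lt_of_le_of_ne h0 fun h => hy (dotProduct_self_eq_zero.1 h.symm)
  have key : ∀ {N : ℕ} (a : ℝ) (l z : Fin N → ℝ), (∀ i, z i ≠ 0 → a ≤ l i) →
      a * ∑ i, z i ^ 2 ≤ ∑ i, l i * z i ^ 2 := fun a l z h => by
    rw [Finset.mul_sum]
    refine Finset.sum_le_sum fun i _ => ?_
    by_cases hz : z i = 0
    · simp [hz]
    · exact mul_le_mul_of_nonneg_right (h i hz) (sq_nonneg _)
  have key' : ∀ {N : ℕ} (a : ℝ) (l z : Fin N → ℝ), (∀ i, z i ≠ 0 → l i ≤ a) →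
      ∑ i, l i * z i ^ 2 ≤ a * ∑ i, z i ^ 2 := fun a l z h => by
    rw [Finset.mul_sum]
    refine Finset.sum_le_sum fun i _ => ?_
    by_cases hz : z i = 0
    · simp [hz]
    · exact mul_le_mul_of_nonneg_right (h i hz) (sq_nonneg _)
  constructor
  · obtain ⟨y, hy0, h1, h2⟩ := aux_ker (c.comp P) c' (Finset.Iio k.castSucc) (Finset.Ioi k)
      (by simp; omega)
    have e1 := key (sortedEig (hypAdj C) k.castSucc) (sortedEig (hypAdj C)) (c (P y))
      fun i hi => hm (not_lt.1 fun hlt => hi (h1 i (by simpa using hlt)))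
    have e2 := key' (sortedEig (hypAdj (C.submatrix v.succAbove id)) k)
      (sortedEig (hypAdj (C.submatrix v.succAbove id))) (c' y)
      fun i hi => hm' (not_lt.1 fun hlt => hi (h2 i (by simpa using hlt)))
    rw [← hc1, ← hc2, hP1, hP2] at e1
    rw [← hc1', ← hc2'] at e2
    exact le_of_mul_le_mul_right (e1.trans e2) (hpos y hy0)
  · obtain ⟨y, hy0, h1, h2⟩ := aux_ker (c.comp P) c' (Finset.Ioi k.succ) (Finset.Iio k)
      (by simp; omega)
    have e1 := key' (sortedEig (hypAdj C) k.succ) (sortedEig (hypAdj C)) (c (P y))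
      fun i hi => hm (not_lt.1 fun hlt => hi (h1 i (by simpa using hlt)))
    have e2 := key (sortedEig (hypAdj (C.submatrix v.succAbove id)) k)
      (sortedEig (hypAdj (C.submatrix v.succAbove id))) (c' y)
      fun i hi => hm' (not_lt.1 fun hlt => hi (h2 i (by simpa using hlt)))
    rw [← hc1, ← hc2, hP1, hP2] at e1
    rw [← hc1', ← hc2'] at e2
    exact le_of_mul_le_mul_right (e2.trans e1) (hpos y hy0)
end

section
/- Let C be an (n+1)×m real matrix encoding a hypergraph with real coefficients G on n+1 vertices with every vertex of positive degree, let v be a vertex, and let C' be the n×m matrix obtained from C by deleting row v (encoding G∖v; the remaining vertices keep their degrees, which stay positive). Let L(G) and L(G∖v) be the normalized Laplacians of C and C' respectively. Then for every k ∈ {1,…,n}: λ_k(L(G)) ≤ λ_k(L(G∖v)) ≤ λ_{k+1}(L(G)). -/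
open Matrix in
lemma sortedEig_spec {N : ℕ} (A : Matrix (Fin N) (Fin N) ℝ) (hA : A.IsHermitian) :
    Monotone (sortedEig A) ∧ ∃ W : Matrix (Fin N) (Fin N) ℝ,
      (∀ y : Fin N → ℝ, y ⬝ᵥ (A *ᵥ y) = ∑ i, sortedEig A i * (W *ᵥ y) i ^ 2) ∧
      (∀ y : Fin N → ℝ, y ⬝ᵥ y = ∑ i, (W *ᵥ y) i ^ 2) := by
  have hs : sortedEig A = hA.eigenvalues ∘ Tuple.sort hA.eigenvalues := by
    unfold sortedEig
    rw [dif_pos hA]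
  refine ⟨by rw [hs]; exact Tuple.monotone_sort _, ?_⟩
  set U : Matrix (Fin N) (Fin N) ℝ := (hA.eigenvectorUnitary : Matrix (Fin N) (Fin N) ℝ) with hU
  have hUU : U * Uᵀ = 1 := by
    have := Unitary.coe_mul_star_self hA.eigenvectorUnitary
    simpa [Matrix.star_eq_conjTranspose] using this
  have hsp : A = U * diagonal hA.eigenvalues * Uᵀ := by
    have := hA.spectral_theorem
    simpa [Unitary.conjStarAlgAut_apply, Matrix.star_eq_conjTranspose, Function.comp_def] using this
  refine ⟨Uᵀ.submatrix (Tuple.sort hA.eigenvalues) id, fun y => ?_, fun y => ?_⟩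
  · have h1 : ∑ i, sortedEig A i *
        ((Uᵀ.submatrix (Tuple.sort hA.eigenvalues) id) *ᵥ y) i ^ 2
        = ∑ i, hA.eigenvalues i * (Uᵀ *ᵥ y) i ^ 2 := by
      rw [hs]
      exact Equiv.sum_comp (Tuple.sort hA.eigenvalues)
        (fun i => hA.eigenvalues i * (Uᵀ *ᵥ y) i ^ 2)
    rw [h1]
    have h2 : A *ᵥ y = U *ᵥ (diagonal hA.eigenvalues *ᵥ (Uᵀ *ᵥ y)) := by
      rw [mulVec_mulVec, mulVec_mulVec, ← hsp]
    rw [h2, dotProduct_mulVec, ← mulVec_transpose]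
    simp only [dotProduct, mulVec_diagonal]
    exact Finset.sum_congr rfl fun i _ => by ring
  · have h1 : ∑ i, ((Uᵀ.submatrix (Tuple.sort hA.eigenvalues) id) *ᵥ y) i ^ 2
        = ∑ i, (Uᵀ *ᵥ y) i ^ 2 :=
      Equiv.sum_comp (Tuple.sort hA.eigenvalues) (fun i => (Uᵀ *ᵥ y) i ^ 2)
    rw [h1]
    have h2 : y = U *ᵥ (Uᵀ *ᵥ y) := by rw [mulVec_mulVec, hUU, one_mulVec]
    conv_lhs => rw [h2, dotProduct_mulVec, ← mulVec_transpose, ← h2]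
    simp only [dotProduct]
    exact Finset.sum_congr rfl fun i _ => by ring

open Matrix in
lemma exists_common_zero {n N M : ℕ} (W : Matrix (Fin n) (Fin n) ℝ) (V : Matrix (Fin M) (Fin N) ℝ)
    (F : (Fin n → ℝ) →ₗ[ℝ] (Fin N → ℝ)) (S : Finset (Fin n)) (T : Finset (Fin M))
    (h : S.card + T.card < n) :
    ∃ y : Fin n → ℝ, y ≠ 0 ∧ (∀ i ∈ S, (W *ᵥ y) i = 0) ∧ (∀ j ∈ T, (V *ᵥ (F y)) j = 0) := by
  let Φ : (Fin n → ℝ) →ₗ[ℝ] ((S → ℝ) × (T → ℝ)) :=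
    (LinearMap.funLeft ℝ ℝ (Subtype.val : S → Fin n) ∘ₗ W.mulVecLin).prod
      (LinearMap.funLeft ℝ ℝ (Subtype.val : T → Fin M) ∘ₗ V.mulVecLin ∘ₗ F)
  have hk : LinearMap.ker Φ ≠ ⊥ := by
    apply LinearMap.ker_ne_bot_of_finrank_lt
    simpa using h
  obtain ⟨y, hy, hy0⟩ := (Submodule.ne_bot_iff _).1 hk
  rw [LinearMap.mem_ker] at hy
  refine ⟨y, hy0, fun i hi => ?_, fun j hj => ?_⟩
  · exact congrFun (congrArg Prod.fst hy) ⟨i, hi⟩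
  · exact congrFun (congrArg Prod.snd hy) ⟨j, hj⟩

open Matrix in
lemma cauchy_interlacing {n : ℕ} (A : Matrix (Fin (n + 1)) (Fin (n + 1)) ℝ) (hA : A.IsHermitian)
    (v : Fin (n + 1)) (k : Fin n) :
    sortedEig A k.castSucc ≤ sortedEig (A.submatrix v.succAbove v.succAbove) k ∧
    sortedEig (A.submatrix v.succAbove v.succAbove) k ≤ sortedEig A k.succ := by
  have hB : (A.submatrix v.succAbove v.succAbove).IsHermitian := hA.submatrix _
  set B := A.submatrix v.succAbove v.succAbove with hBdef
  obtain ⟨mA, V, hV1, hV2⟩ := sortedEig_spec A hA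
  obtain ⟨mB, W, hW1, hW2⟩ := sortedEig_spec B hB
  let F : (Fin n → ℝ) →ₗ[ℝ] (Fin (n + 1) → ℝ) :=
    { toFun := fun y => v.insertNth (0 : ℝ) y
      map_add' := fun x y => by
        ext i
        refine Fin.succAboveCases v ?_ (fun j => ?_) i <;> simp
      map_smul' := fun c y => by
        ext i
        refine Fin.succAboveCases v ?_ (fun j => ?_) i <;> simp }
  have hFv : ∀ y, F y v = 0 := fun y => by simp [F]
  have hFs : ∀ y i, F y (v.succAbove i) = y i := fun y i => by simp [F]
  have hF2 : ∀ y, F y ⬝ᵥ F y = y ⬝ᵥ y := fun y => by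
    simp [dotProduct, Fin.sum_univ_succAbove _ v, hFv, hFs]
  have hF1 : ∀ y, F y ⬝ᵥ (A *ᵥ F y) = y ⬝ᵥ (B *ᵥ y) := fun y => by
    simp [dotProduct, mulVec, Fin.sum_univ_succAbove _ v, hFv, hFs, hBdef]
  have pos : ∀ y : Fin n → ℝ, y ≠ 0 → 0 < y ⬝ᵥ y := fun y hy => by
    have h0 : 0 ≤ y ⬝ᵥ y := Finset.sum_nonneg fun i _ => mul_self_nonneg _
    exact lt_of_le_of_ne h0 fun h => hy (dotProduct_self_eq_zero.1 h.symm)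
  have kk := k.isLt
  constructor
  · obtain ⟨y, hy, h1, h2⟩ := exists_common_zero W V F (Finset.Ioi k) (Finset.Iio k.castSucc)
      (by simp; omega)
    have up : y ⬝ᵥ (B *ᵥ y) ≤ sortedEig B k * (y ⬝ᵥ y) := by
      rw [hW1, hW2, Finset.mul_sum]
      refine Finset.sum_le_sum fun i _ => ?_
      rcases lt_or_ge k i with h | h
      · simp [h1 i (by simpa using h)]
      · exact mul_le_mul_of_nonneg_right (mB h) (sq_nonneg _)
    have lo : sortedEig A k.castSucc * (y ⬝ᵥ y) ≤ y ⬝ᵥ (B *ᵥ y) := by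
      rw [← hF1, ← hF2, hV1, hV2, Finset.mul_sum]
      refine Finset.sum_le_sum fun i _ => ?_
      rcases lt_or_ge i k.castSucc with h | h
      · simp [h2 i (by simpa using h)]
      · exact mul_le_mul_of_nonneg_right (mA h) (sq_nonneg _)
    exact le_of_mul_le_mul_right (lo.trans up) (pos y hy)
  · obtain ⟨y, hy, h1, h2⟩ := exists_common_zero W V F (Finset.Iio k) (Finset.Ioi k.succ)
      (by simp; omega)
    have lo : sortedEig B k * (y ⬝ᵥ y) ≤ y ⬝ᵥ (B *ᵥ y) := by
      rw [hW1, hW2, Finset.mul_sum]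
      refine Finset.sum_le_sum fun i _ => ?_
      rcases lt_or_ge i k with h | h
      · simp [h1 i (by simpa using h)]
      · exact mul_le_mul_of_nonneg_right (mB h) (sq_nonneg _)
    have up : y ⬝ᵥ (B *ᵥ y) ≤ sortedEig A k.succ * (y ⬝ᵥ y) := by
      rw [← hF1, ← hF2, hV1, hV2, Finset.mul_sum]
      refine Finset.sum_le_sum fun i _ => ?_
      rcases lt_or_ge k.succ i with h | h
      · simp [h2 i (by simpa using h)]
      · exact mul_le_mul_of_nonneg_right (mA h) (sq_nonneg _)
    exact le_of_mul_le_mul_right (lo.trans up) (pos y hy)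

lemma hypNormLap_apply {n m : ℕ} (C : Matrix (Fin n) (Fin m) ℝ) (i j : Fin n) :
    hypNormLap C i j = (if i = j then 1 else 0) - (Real.sqrt (hypDeg C i))⁻¹ *
      (if i = j then 0 else -∑ e, C i e * C j e) * (Real.sqrt (hypDeg C j))⁻¹ := by
  simp only [hypNormLap, Matrix.sub_apply, Matrix.mul_diagonal, Matrix.diagonal_mul,
    Matrix.one_apply, hypAdj, Matrix.of_apply]

lemma hypNormLap_isHermitian {n m : ℕ} (C : Matrix (Fin n) (Fin m) ℝ) :
    (hypNormLap C).IsHermitian := by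
  refine Matrix.IsHermitian.ext fun i j => ?_
  rw [hypNormLap_apply, hypNormLap_apply, star_trivial]
  by_cases h : i = j
  · subst h; rfl
  · rw [if_neg h, if_neg h, if_neg (Ne.symm h), if_neg (Ne.symm h)]
    simp only [mul_comm (C j _)]
    ring

lemma hypNormLap_submatrix {n m : ℕ} (C : Matrix (Fin (n + 1)) (Fin m) ℝ) (v : Fin (n + 1)) :
    hypNormLap (C.submatrix v.succAbove id) =
      (hypNormLap C).submatrix v.succAbove v.succAbove := by
  ext i j
  rw [Matrix.submatrix_apply, hypNormLap_apply, hypNormLap_apply]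
  simp [hypDeg]

/-- Interlacing for the normalized Laplacian under vertex deletion. -/
theorem normLap_interlacing_vertex {n m : ℕ} (C : Matrix (Fin (n + 1)) (Fin m) ℝ)
    (hdeg : ∀ i, 0 < hypDeg C i) (v : Fin (n + 1)) (k : Fin n) :
    sortedEig (hypNormLap C) k.castSucc ≤
      sortedEig (hypNormLap (C.submatrix v.succAbove id)) k ∧
    sortedEig (hypNormLap (C.submatrix v.succAbove id)) k ≤
      sortedEig (hypNormLap C) k.succ := by
  rw [hypNormLap_submatrix]
  exact cauchy_interlacing _ (hypNormLap_isHermitian C) v k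
end

section
/- Let Q be an n×n real symmetric matrix and M an m×m real symmetric matrix, and suppose there exist r, l with n − r = m − l ≥ 1 and a matrix P of size (n−r)×(n−r) that is a principal submatrix of both Q and M (i.e. P = Q.submatrix f f for some injective f : Fin (n−r) → Fin n and P = M.submatrix g g for some injective g : Fin (m−l) → Fin m). Then for every k ∈ {l+1, …, n−r}: λ_{k−l}(Q) ≤ λ_k(M) ≤ λ_{k+r}(Q). -/
open Matrix

lemma cps_quad {n : ℕ} (A : Matrix (Fin n) (Fin n) ℝ) (hA : A.IsSymm) :
    Monotone (sortedEig A) ∧ ∃ b : Fin n → Fin n → ℝ, ∀ y : Fin n → ℝ,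
      y ⬝ᵥ (A *ᵥ y) = ∑ k, sortedEig A k * (b k ⬝ᵥ y) ^ 2 ∧
      y ⬝ᵥ y = ∑ k, (b k ⬝ᵥ y) ^ 2 := by
  have hH : A.IsHermitian := by
    rw [Matrix.IsHermitian, Matrix.conjTranspose_eq_transpose_of_trivial]; exact hA
  have hs : sortedEig A = hH.eigenvalues ∘ Tuple.sort hH.eigenvalues := by
    unfold sortedEig; rw [dif_pos hH]
  refine ⟨by rw [hs]; exact Tuple.monotone_sort _, ?_⟩
  set σ := Tuple.sort hH.eigenvalues with hσ
  set e := hH.eigenvectorBasis with he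
  have key : ∀ y z : Fin n → ℝ, y ⬝ᵥ z =
      ∑ k, ((e (σ k)).ofLp ⬝ᵥ y) * ((e (σ k)).ofLp ⬝ᵥ z) := by
    intro y z
    have h := e.sum_inner_mul_inner (WithLp.toLp 2 y) (WithLp.toLp 2 z)
    rw [Equiv.sum_comp σ (fun k => ((e k).ofLp ⬝ᵥ y) * ((e k).ofLp ⬝ᵥ z))]
    simp only [EuclideanSpace.inner_eq_star_dotProduct, star_trivial] at h
    rw [dotProduct_comm y z, ← h]
    refine Finset.sum_congr rfl fun k _ => ?_
    rw [dotProduct_comm z]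
  refine ⟨fun k => (e (σ k)).ofLp, fun y => ⟨?_, ?_⟩⟩
  · rw [key]
    refine Finset.sum_congr rfl fun k _ => ?_
    have h1 : (e (σ k)).ofLp ⬝ᵥ (A *ᵥ y) = sortedEig A k * ((e (σ k)).ofLp ⬝ᵥ y) := by
      rw [dotProduct_mulVec, ← mulVec_transpose, hA.eq, he, hH.mulVec_eigenvectorBasis, hs,
        smul_dotProduct]
      rfl
    rw [h1]; ring
  · rw [key]
    exact Finset.sum_congr rfl fun k _ => by ring

lemma cps_ext {n p : ℕ} (A : Matrix (Fin n) (Fin n) ℝ) (f : Fin p → Fin n)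
    (hf : Function.Injective f) (x : Fin p → ℝ) :
    ((1 : Matrix (Fin n) (Fin n) ℝ).submatrix id f *ᵥ x) ⬝ᵥ
      (A *ᵥ ((1 : Matrix (Fin n) (Fin n) ℝ).submatrix id f *ᵥ x)) =
      x ⬝ᵥ (A.submatrix f f *ᵥ x) := by
  have h : A.submatrix f f = ((1 : Matrix (Fin n) (Fin n) ℝ).submatrix id f)ᵀ *
      (A * (1 : Matrix (Fin n) (Fin n) ℝ).submatrix id f) := by
    ext i j
    simp [Matrix.mul_apply, Matrix.one_apply]
  rw [h, ← mulVec_mulVec, ← mulVec_mulVec, dotProduct_mulVec x, vecMul_transpose]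

lemma cps_main {n m p : ℕ}
    (A : Matrix (Fin n) (Fin n) ℝ) (hA : A.IsSymm)
    (B : Matrix (Fin m) (Fin m) ℝ) (hB : B.IsSymm)
    (f : Fin p → Fin n) (hf : Function.Injective f)
    (g : Fin p → Fin m) (hg : Function.Injective g)
    (hAB : A.submatrix f f = B.submatrix g g)
    (i : Fin n) (j : Fin m) (hij : (i : ℕ) + m < p + j + 1) :
    sortedEig A i ≤ sortedEig B j := by
  obtain ⟨mA, a, ha⟩ := cps_quad A hA
  obtain ⟨mB, b, hb⟩ := cps_quad B hB
  set E := (1 : Matrix (Fin n) (Fin n) ℝ).submatrix id f with hE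
  set F := (1 : Matrix (Fin m) (Fin m) ℝ).submatrix id g with hF
  let L : (Fin p → ℝ) →ₗ[ℝ] (Fin i ⊕ Fin (m - 1 - j) → ℝ) :=
    (Matrix.of (Sum.elim (fun s : Fin i => a ⟨s, by omega⟩ ᵥ* E)
      (fun s : Fin (m - 1 - j) => b ⟨j + 1 + s, by omega⟩ ᵥ* F))).mulVecLin
  have hker : LinearMap.ker L ≠ ⊥ := by
    apply LinearMap.ker_ne_bot_of_finrank_lt
    simp
    omega
  obtain ⟨x, hx, hx0⟩ := (Submodule.ne_bot_iff _).1 hker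
  have hL : L x = 0 := hx
  have c1 : ∀ k : Fin n, k < i → a k ⬝ᵥ (E *ᵥ x) = 0 := by
    intro k hk
    have := congrFun hL (Sum.inl ⟨k, hk⟩)
    rw [dotProduct_mulVec]; exact this
  have c2 : ∀ k : Fin m, j < k → b k ⬝ᵥ (F *ᵥ x) = 0 := by
    intro k hk
    have hk' : (j : ℕ) < k := hk
    have := congrFun hL (Sum.inr ⟨k - (j + 1), by omega⟩)
    have e : (⟨j + 1 + (k - (j + 1)), by omega⟩ : Fin m) = k := by ext; simp; omega
    rw [dotProduct_mulVec]
    have h2 : b ⟨j + 1 + (k - (j + 1)), by omega⟩ ᵥ* F ⬝ᵥ x = 0 := this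
    rwa [e] at h2
  have nA : (E *ᵥ x) ⬝ᵥ (E *ᵥ x) = x ⬝ᵥ x := by
    have := cps_ext 1 f hf x
    rwa [one_mulVec, submatrix_one _ hf, one_mulVec] at this
  have nB : (F *ᵥ x) ⬝ᵥ (F *ᵥ x) = x ⬝ᵥ x := by
    have := cps_ext 1 g hg x
    rwa [one_mulVec, submatrix_one _ hg, one_mulVec] at this
  have lo : sortedEig A i * (x ⬝ᵥ x) ≤ x ⬝ᵥ (A.submatrix f f *ᵥ x) := by
    rw [← cps_ext A f hf x, ← nA, (ha _).1, (ha (E *ᵥ x)).2, Finset.mul_sum]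
    refine Finset.sum_le_sum fun k _ => ?_
    rcases lt_or_ge k i with h | h
    · rw [c1 k h]; simp
    · exact mul_le_mul_of_nonneg_right (mA h) (sq_nonneg _)
  have hi : x ⬝ᵥ (A.submatrix f f *ᵥ x) ≤ sortedEig B j * (x ⬝ᵥ x) := by
    rw [hAB, ← cps_ext B g hg x, ← nB, (hb _).1, (hb (F *ᵥ x)).2, Finset.mul_sum]
    refine Finset.sum_le_sum fun k _ => ?_
    rcases lt_or_ge j k with h | h
    · rw [c2 k h]; simp
    · exact mul_le_mul_of_nonneg_right (mB h) (sq_nonneg _)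
  have pos : 0 < x ⬝ᵥ x := by
    have h0 : 0 ≤ x ⬝ᵥ x := Finset.sum_nonneg fun k _ => mul_self_nonneg _
    exact lt_of_le_of_ne h0 fun h => hx0 (dotProduct_self_eq_zero.1 h.symm)
  exact le_of_mul_le_mul_right (lo.trans hi) pos

/-- If `P` is a common principal submatrix of the real symmetric matrices `Q` (of size
`n = p + r`) and `M` (of size `m = p + l`), with `p ≥ 1`, then for `l + 1 ≤ k ≤ n - r`
one has `λ_{k-l}(Q) ≤ λ_k(M) ≤ λ_{k+r}(Q)` (eigenvalue indices 1-based). -/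
theorem common_principal_submatrix_interlacing {n m p r l : ℕ} (hp : 1 ≤ p)
    (hn : n = p + r) (hm : m = p + l)
    (Q : Matrix (Fin n) (Fin n) ℝ) (hQ : Q.IsSymm)
    (M : Matrix (Fin m) (Fin m) ℝ) (hM : M.IsSymm)
    (P : Matrix (Fin p) (Fin p) ℝ)
    (f : Fin p → Fin n) (hf : Function.Injective f) (hPf : P = Q.submatrix f f)
    (g : Fin p → Fin m) (hg : Function.Injective g) (hPg : P = M.submatrix g g)
    (k : ℕ) (hk1 : l + 1 ≤ k) (hk2 : k ≤ n - r) :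
    sortedEig Q ⟨k - l - 1, by omega⟩ ≤ sortedEig M ⟨k - 1, by omega⟩ ∧
    sortedEig M ⟨k - 1, by omega⟩ ≤ sortedEig Q ⟨k + r - 1, by omega⟩ := by
  subst hPf
  constructor
  · exact cps_main Q hQ M hM f hf g hg hPg _ _ (by simp only; omega)
  · exact cps_main M hM Q hQ g hg f hf hPg.symm _ _ (by simp only; omega)
end

section
/- Let C be an n×m real matrix encoding a hypergraph with real coefficients G in which every vertex has positive degree, and let ê be an edge of cardinality t ≥ 2 (i.e. exactly t indices i satisfy C i ê ≠ 0) such that every vertex still has positive degree after column ê is deleted. Let L(G) be the normalized Laplacian of C and L(G∖ê) the normalized Laplacian of the matrix obtained from C by deleting column ê. Then for every k ∈ {t, …, n}: λ_{k−t+1}(L(G)) ≤ λ_k(L(G∖ê)). -/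
open Matrix

lemma aux_sortedEig_mono {n : ℕ} (A : Matrix (Fin n) (Fin n) ℝ) (hA : A.IsHermitian) :
    Monotone (sortedEig A) := by
  unfold sortedEig
  rw [dif_pos hA]
  exact Tuple.monotone_sort _

lemma aux_spec {n : ℕ} (A : Matrix (Fin n) (Fin n) ℝ) (hA : A.IsHermitian) :
    ∃ f : (Fin n → ℝ) →ₗ[ℝ] (Fin n → ℝ), ∀ x, x ⬝ᵥ x = ∑ i, (f x i) ^ 2 ∧
      x ⬝ᵥ (A *ᵥ x) = ∑ i, sortedEig A i * (f x i) ^ 2 := by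
  have hs := hA.spectral_theorem
  rw [Unitary.conjStarAlgAut_apply] at hs
  have hU : (hA.eigenvectorUnitary : Matrix (Fin n) (Fin n) ℝ) *
      star (hA.eigenvectorUnitary : Matrix (Fin n) (Fin n) ℝ) = 1 := by
    simp
  set P : Matrix (Fin n) (Fin n) ℝ := (hA.eigenvectorUnitary : Matrix (Fin n) (Fin n) ℝ) with hP
  have hst : star P = Pᵀ := by
    ext i j; simp [Matrix.star_apply]
  rw [hst] at hU
  refine ⟨(LinearMap.funLeft ℝ ℝ (Tuple.sort hA.eigenvalues)) ∘ₗ Matrix.mulVecLin Pᵀ, ?_⟩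
  intro x
  constructor
  · have h1 : x ⬝ᵥ x = (Pᵀ *ᵥ x) ⬝ᵥ (Pᵀ *ᵥ x) := by
      rw [Matrix.dotProduct_mulVec, Matrix.vecMul_mulVec, Matrix.transpose_transpose, hU, Matrix.vecMul_one]
    rw [h1]
    simp only [LinearMap.comp_apply, LinearMap.funLeft_apply, Matrix.mulVecLin_apply]
    rw [Equiv.sum_comp (Tuple.sort hA.eigenvalues) (fun i => (Pᵀ *ᵥ x) i ^ 2)]
    simp [dotProduct, sq]
  · have h1 : x ⬝ᵥ (A *ᵥ x) = (Pᵀ *ᵥ x) ⬝ᵥ (Matrix.diagonal hA.eigenvalues *ᵥ (Pᵀ *ᵥ x)) := by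
      have : A = P * Matrix.diagonal hA.eigenvalues * Pᵀ := by
        rw [← hst]; exact hs
      conv_lhs => rw [this]
      rw [← Matrix.mulVec_mulVec, ← Matrix.mulVec_mulVec, Matrix.dotProduct_mulVec x P,
        Matrix.mulVec_transpose]
    rw [h1]
    unfold sortedEig
    rw [dif_pos hA]
    simp only [LinearMap.comp_apply, LinearMap.funLeft_apply, Matrix.mulVecLin_apply, Function.comp]
    rw [Equiv.sum_comp (Tuple.sort hA.eigenvalues)
      (fun i => hA.eigenvalues i * (Pᵀ *ᵥ x) i ^ 2)]
    simp only [dotProduct, Matrix.mulVec_diagonal]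
    refine Finset.sum_congr rfl fun i _ => by ring

lemma aux_entry {n : ℕ} {E : Type*} [Fintype E] (C : Matrix (Fin n) E ℝ)
    (hd : ∀ i, 0 < hypDeg C i) (i j : Fin n) :
    hypNormLap C i j =
      (Real.sqrt (hypDeg C i))⁻¹ * (∑ e, C i e * C j e) * (Real.sqrt (hypDeg C j))⁻¹ := by
  unfold hypNormLap
  rw [Matrix.sub_apply, Matrix.mul_diagonal, Matrix.diagonal_mul]
  by_cases h : i = j
  · subst h
    have h1 : ∑ e, C i e * C i e = hypDeg C i := by
      unfold hypDeg; exact Finset.sum_congr rfl fun e _ => by ring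
    have h2 := Real.sq_sqrt (hd i).le
    have h3 := Real.sqrt_pos.2 (hd i)
    rw [h1]
    simp only [hypAdj, Matrix.of_apply, Matrix.one_apply_eq, if_true]
    field_simp
    nlinarith
  · simp [hypAdj, h]

lemma aux_herm {n : ℕ} {E : Type*} [Fintype E] (C : Matrix (Fin n) E ℝ)
    (hd : ∀ i, 0 < hypDeg C i) : (hypNormLap C).IsHermitian := by
  ext i j
  rw [Matrix.conjTranspose_apply, star_trivial, aux_entry C hd, aux_entry C hd]
  simp_rw [mul_comm (C j _)]
  ring

lemma aux_quad {n : ℕ} {E : Type*} [Fintype E] (C : Matrix (Fin n) E ℝ)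
    (hd : ∀ i, 0 < hypDeg C i) (y : Fin n → ℝ) :
    (fun i => Real.sqrt (hypDeg C i) * y i) ⬝ᵥ
      (hypNormLap C *ᵥ (fun i => Real.sqrt (hypDeg C i) * y i)) =
      ∑ e, (∑ i, C i e * y i) ^ 2 := by
  have key : ∀ i j e, Real.sqrt (hypDeg C i) * y i * ((Real.sqrt (hypDeg C i))⁻¹ * (C i e * C j e) *
      (Real.sqrt (hypDeg C j))⁻¹ * (Real.sqrt (hypDeg C j) * y j)) = C i e * y i * (C j e * y j) := by
    intro i j e
    have h3 := (Real.sqrt_pos.2 (hd i)).ne'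
    have h4 := (Real.sqrt_pos.2 (hd j)).ne'
    field_simp
  have hR : ∑ e, (∑ i, C i e * y i) ^ 2 = ∑ i, ∑ j, ∑ e, C i e * y i * (C j e * y j) := by
    simp only [sq, Finset.sum_mul_sum]
    rw [Finset.sum_comm]
    exact Finset.sum_congr rfl fun i _ => Finset.sum_comm
  rw [hR]
  simp only [dotProduct, Matrix.mulVec, aux_entry C hd]
  refine Finset.sum_congr rfl fun i _ => ?_
  rw [Finset.mul_sum]
  refine Finset.sum_congr rfl fun j _ => ?_
  simp only [← key, Finset.mul_sum, Finset.sum_mul]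

lemma aux_den {n : ℕ} {E : Type*} [Fintype E] (C : Matrix (Fin n) E ℝ)
    (hd : ∀ i, 0 < hypDeg C i) (y : Fin n → ℝ) :
    (fun i => Real.sqrt (hypDeg C i) * y i) ⬝ᵥ (fun i => Real.sqrt (hypDeg C i) * y i) =
      ∑ i, hypDeg C i * y i ^ 2 := by
  simp only [dotProduct]
  refine Finset.sum_congr rfl fun i _ => ?_
  nlinarith [Real.sq_sqrt (hd i).le]

/-- Scaling as a linear map. -/
noncomputable def auxScale {n : ℕ} (d : Fin n → ℝ) : (Fin n → ℝ) →ₗ[ℝ] (Fin n → ℝ) :=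
  Matrix.mulVecLin (Matrix.diagonal d)

lemma auxScale_apply {n : ℕ} (d y : Fin n → ℝ) : auxScale d y = fun i => d i * y i := by
  ext i; simp [auxScale, Matrix.mulVec_diagonal]

/-- If `ehat` is an edge of cardinality `t ≥ 2`, then for `t ≤ k ≤ n` (1-based),
`λ_{k-t+1}(L(G)) ≤ λ_k(L(G∖ehat))`. -/
theorem normLap_edge_deletion_lower {n m : ℕ} (C : Matrix (Fin n) (Fin m) ℝ)
    (ehat : Fin m)
    (hdeg : ∀ i, 0 < hypDeg C i)
    (hdeg' : ∀ i,
      0 < hypDeg (C.submatrix id (fun e : {e : Fin m // e ≠ ehat} => (e : Fin m))) i)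
    (t : ℕ) (ht2 : 2 ≤ t) (ht : ({i : Fin n | C i ehat ≠ 0}).ncard = t)
    (k : ℕ) (hk1 : t ≤ k) (hk2 : k ≤ n) :
    sortedEig (hypNormLap C) ⟨k - t, by omega⟩ ≤
      sortedEig (hypNormLap (C.submatrix id (fun e : {e : Fin m // e ≠ ehat} => (e : Fin m))))
        ⟨k - 1, by omega⟩ := by
  set C' := C.submatrix id (fun e : {e : Fin m // e ≠ ehat} => (e : Fin m)) with hC'
  have hH := aux_herm C hdeg
  have hH' := aux_herm C' hdeg'
  have hm := aux_sortedEig_mono _ hH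
  have hm' := aux_sortedEig_mono _ hH'
  obtain ⟨f, hf⟩ := aux_spec _ hH
  obtain ⟨f', hf'⟩ := aux_spec _ hH'
  have hk2' : k - 2 < n := by omega
  have hk1' : k - 1 < n := by omega
  refine (hm (show (⟨k - t, by omega⟩ : Fin n) ≤ ⟨k - 2, hk2'⟩ from
    Fin.mk_le_mk.2 (by omega))).trans ?_
  set g := f ∘ₗ auxScale (fun i => Real.sqrt (hypDeg C i)) with hg
  set g' := f' ∘ₗ auxScale (fun i => Real.sqrt (hypDeg C' i)) with hg'
  let F : (Fin n → ℝ) →ₗ[ℝ] ((Fin (n - k) → ℝ) × (Fin (k - 2) → ℝ) × ℝ) :=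
    ((LinearMap.funLeft ℝ ℝ (fun i : Fin (n - k) => (⟨k + i, by omega⟩ : Fin n))) ∘ₗ g').prod
     (((LinearMap.funLeft ℝ ℝ (fun i : Fin (k - 2) => (⟨i, by omega⟩ : Fin n))) ∘ₗ g).prod
      (dotProductBilin ℝ ℝ (fun i => C i ehat)))
  have hker : LinearMap.ker F ≠ ⊥ := by
    apply LinearMap.ker_ne_bot_of_finrank_lt
    simp only [Module.finrank_prod, Module.finrank_fin_fun, Module.finrank_self]
    omega
  obtain ⟨y, hyF, hy0⟩ := Submodule.exists_mem_ne_zero_of_ne_bot hker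
  rw [LinearMap.mem_ker] at hyF
  have e1 : ∀ i : Fin n, k - 1 < (i : ℕ) → g' y i = 0 := by
    intro i hi
    have : g' y ⟨k + (i - k), by omega⟩ = 0 :=
      congrFun (congrArg Prod.fst hyF) ⟨i - k, by omega⟩
    have hh : (⟨k + (i - k), by omega⟩ : Fin n) = i := Fin.ext (by simp; omega)
    rw [hh] at this
    exact this
  have e2 : ∀ i : Fin n, (i : ℕ) < k - 2 → g y i = 0 := by
    intro i hi
    exact congrFun (congrArg (fun z => z.2.1) hyF) ⟨i, hi⟩
  have e3 : ∑ i, C i ehat * y i = 0 := congrArg (fun z => z.2.2) hyF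
  set ν := sortedEig (hypNormLap C) ⟨k - 2, hk2'⟩
  set μ := sortedEig (hypNormLap C') ⟨k - 1, hk1'⟩
  have a1 := hf (fun i => Real.sqrt (hypDeg C i) * y i)
  have a2 := hf' (fun i => Real.sqrt (hypDeg C' i) * y i)
  rw [aux_den C hdeg, aux_quad C hdeg, ← auxScale_apply (fun i => Real.sqrt (hypDeg C i)) y,
    ← LinearMap.comp_apply, ← hg] at a1
  rw [aux_den C' hdeg', aux_quad C' hdeg', ← auxScale_apply (fun i => Real.sqrt (hypDeg C' i)) y,
    ← LinearMap.comp_apply, ← hg'] at a2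
  have hnum : ∑ e, (∑ i, C i e * y i) ^ 2 = ∑ e, (∑ i, C' i e * y i) ^ 2 := by
    rw [Fintype.sum_eq_add_sum_subtype_ne _ ehat, e3]
    simp [hC']
  have hdd : ∀ i, hypDeg C' i ≤ hypDeg C i := by
    intro i
    unfold hypDeg
    rw [Fintype.sum_eq_add_sum_subtype_ne (fun e => C i e ^ 2) ehat]
    simp only [hC', Matrix.submatrix_apply, id]
    nlinarith [sq_nonneg (C i ehat)]
  have b1 : ν * ∑ i, hypDeg C i * y i ^ 2 ≤ ∑ e, (∑ i, C i e * y i) ^ 2 := by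
    rw [a1.1, a1.2, Finset.mul_sum]
    refine Finset.sum_le_sum fun i _ => ?_
    by_cases hi : (i : ℕ) < k - 2
    · rw [e2 i hi]; simp
    · exact mul_le_mul_of_nonneg_right (hm (Fin.mk_le_of_le_val (by omega))) (sq_nonneg _)
  have b2 : ∑ e, (∑ i, C' i e * y i) ^ 2 ≤ μ * ∑ i, hypDeg C' i * y i ^ 2 := by
    rw [a2.1, a2.2, Finset.mul_sum]
    refine Finset.sum_le_sum fun i _ => ?_
    by_cases hi : k - 1 < (i : ℕ)
    · rw [e1 i hi]; simp
    · exact mul_le_mul_of_nonneg_right (hm' (Fin.le_def.2 (by simp; omega))) (sq_nonneg _)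
  have c0 : 0 < ∑ i, hypDeg C' i * y i ^ 2 := by
    obtain ⟨i, hi⟩ := Function.ne_iff.1 hy0
    refine Finset.sum_pos' (fun i _ => mul_nonneg (hdeg' i).le (sq_nonneg _))
      ⟨i, Finset.mem_univ _, mul_pos (hdeg' i) (by have : y i ≠ 0 := hi
                                                   positivity)⟩
  have c1 : ∑ i, hypDeg C' i * y i ^ 2 ≤ ∑ i, hypDeg C i * y i ^ 2 :=
    Finset.sum_le_sum fun i _ => mul_le_mul_of_nonneg_right (hdd i) (sq_nonneg _)
  have c2 : 0 ≤ ∑ e, (∑ i, C' i e * y i) ^ 2 := Finset.sum_nonneg fun _ _ => sq_nonneg _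
  have c3 : 0 ≤ μ := nonneg_of_mul_nonneg_left (c2.trans b2) c0
  have c4 := mul_le_mul_of_nonneg_left c1 c3
  refine le_of_mul_le_mul_right ?_ (c0.trans_le c1)
  linarith
end

section
/- Let C be an n×m real matrix encoding a hypergraph with real coefficients G in which every vertex has positive degree, and let F be a set of edges such that every edge e ∈ F has cardinality |e| ≥ 2, such that every vertex still has positive degree after the columns in F are deleted, and set t = ∑_{e ∈ F} |e|. Let L(G) be the normalized Laplacian of C and L(G∖F) the normalized Laplacian of the matrix obtained from C by deleting the columns in F. Then for every k ∈ {1,…,n} with k − t + |F| ≥ 1: λ_{k−t+|F|}(L(G)) ≤ λ_k(L(G∖F)). -/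
open Matrix

theorem nl_factor {n : ℕ} {E : Type*} [Fintype E] (C : Matrix (Fin n) E ℝ)
    (h : ∀ i, 0 < hypDeg C i) :
    hypNormLap C = (Matrix.of fun i e => (Real.sqrt (hypDeg C i))⁻¹ * C i e) *
      (Matrix.of fun i e => (Real.sqrt (hypDeg C i))⁻¹ * C i e)ᵀ := by
  ext i j
  have e1 : ∑ e, (Real.sqrt (hypDeg C i))⁻¹ * C i e * ((Real.sqrt (hypDeg C j))⁻¹ * C j e)
      = (Real.sqrt (hypDeg C i))⁻¹ * (∑ e, C i e * C j e) * (Real.sqrt (hypDeg C j))⁻¹ := by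
    rw [Finset.mul_sum, Finset.sum_mul]
    exact Finset.sum_congr rfl fun e _ => by ring
  rw [Matrix.mul_apply]
  simp only [Matrix.of_apply, Matrix.transpose_apply]
  rw [e1]
  simp only [hypNormLap, Matrix.sub_apply, Matrix.mul_diagonal, Matrix.diagonal_mul, hypAdj,
    Matrix.of_apply]
  by_cases hij : i = j
  · subst hij
    have hs : ∑ e, C i e * C i e = Real.sqrt (hypDeg C i) * Real.sqrt (hypDeg C i) := by
      rw [Real.mul_self_sqrt (h i).le]
      exact Finset.sum_congr rfl fun e _ => by ring
    have hp := Real.sqrt_pos.2 (h i)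
    rw [hs]
    simp
    field_simp
  · simp [hij]

theorem nl_quad {n : ℕ} {E : Type*} [Fintype E] (C : Matrix (Fin n) E ℝ)
    (h : ∀ i, 0 < hypDeg C i) (f : Fin n → ℝ) :
    (fun i => Real.sqrt (hypDeg C i) * f i) ⬝ᵥ
      (hypNormLap C *ᵥ fun i => Real.sqrt (hypDeg C i) * f i) = ∑ e, (∑ i, C i e * f i) ^ 2 := by
  rw [nl_factor C h, ← Matrix.mulVec_mulVec, Matrix.dotProduct_mulVec, ← Matrix.mulVec_transpose]
  simp only [dotProduct, Matrix.mulVec, Matrix.transpose_apply, Matrix.of_apply]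
  refine Finset.sum_congr rfl fun e _ => ?_
  have : ∀ i, (Real.sqrt (hypDeg C i))⁻¹ * C i e * (Real.sqrt (hypDeg C i) * f i) = C i e * f i := by
    intro i
    have hp := Real.sqrt_pos.2 (h i)
    field_simp
  simp only [this]
  ring

theorem nl_herm {n : ℕ} {E : Type*} [Fintype E] (C : Matrix (Fin n) E ℝ)
    (h : ∀ i, 0 < hypDeg C i) : (hypNormLap C).IsHermitian := by
  rw [nl_factor C h, ← Matrix.conjTranspose_eq_transpose_of_trivial]
  exact Matrix.isHermitian_mul_conjTranspose_self _

theorem spec_data {n : ℕ} (A : Matrix (Fin n) (Fin n) ℝ) (hA : A.IsHermitian) :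
    Monotone (sortedEig A) ∧ ∃ V : Matrix (Fin n) (Fin n) ℝ, V * Vᵀ = 1 ∧
      A = V * Matrix.diagonal (sortedEig A) * Vᵀ := by
  have hs : sortedEig A = hA.eigenvalues ∘ Tuple.sort hA.eigenvalues := by
    unfold sortedEig; exact dif_pos hA
  rw [hs]
  refine ⟨Tuple.monotone_sort _, 
    (hA.eigenvectorUnitary : Matrix (Fin n) (Fin n) ℝ).submatrix id (Tuple.sort hA.eigenvalues),
    ?_, ?_⟩
  · rw [Matrix.transpose_submatrix, Matrix.submatrix_mul_equiv]
    have := Matrix.mem_unitaryGroup_iff.1 hA.eigenvectorUnitary.2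
    rw [Matrix.star_eq_conjTranspose, Matrix.conjTranspose_eq_transpose_of_trivial] at this
    rw [this]; rfl
  · have h1 : Matrix.diagonal (hA.eigenvalues ∘ Tuple.sort hA.eigenvalues) =
      (Matrix.diagonal hA.eigenvalues).submatrix (Tuple.sort hA.eigenvalues)
        (Tuple.sort hA.eigenvalues) := by
      rw [Matrix.submatrix_diagonal_equiv]
    rw [h1, Matrix.transpose_submatrix, Matrix.submatrix_mul_equiv, Matrix.submatrix_mul_equiv]
    have := hA.spectral_theorem
    rw [Unitary.conjStarAlgAut_apply, Matrix.star_eq_conjTranspose,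
      Matrix.conjTranspose_eq_transpose_of_trivial] at this
    exact this

theorem quad_diag {n : ℕ} (V : Matrix (Fin n) (Fin n) ℝ) (d x : Fin n → ℝ) :
    x ⬝ᵥ ((V * Matrix.diagonal d * Vᵀ) *ᵥ x) = ∑ i, d i * ((Vᵀ *ᵥ x) i) ^ 2 := by
  rw [← Matrix.mulVec_mulVec, ← Matrix.mulVec_mulVec, Matrix.dotProduct_mulVec,
    ← Matrix.mulVec_transpose]
  simp only [dotProduct, Matrix.mulVec_diagonal]
  exact Finset.sum_congr rfl fun e _ => by ring

theorem norm_diag {n : ℕ} (V : Matrix (Fin n) (Fin n) ℝ) (h : V * Vᵀ = 1) (x : Fin n → ℝ) :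
    ∑ i, ((Vᵀ *ᵥ x) i) ^ 2 = ∑ i, x i ^ 2 := by
  have := quad_diag V (fun _ => 1) x
  simp only [Matrix.diagonal_one, Matrix.mul_one, h, Matrix.one_mulVec, one_mul] at this
  rw [← this]
  exact Finset.sum_congr rfl fun e _ => by ring

/-- If `F` is a set of edges each of cardinality `≥ 2` and `t = ∑_{e ∈ F} |e|`, then for
every `1 ≤ k ≤ n` with `k - t + |F| ≥ 1` (1-based indices),
`λ_{k-t+|F|}(L(G)) ≤ λ_k(L(G∖F))`. -/
theorem normLap_edges_deletion_lower {n m : ℕ} (C : Matrix (Fin n) (Fin m) ℝ)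
    (hdeg : ∀ i, 0 < hypDeg C i)
    (F : Finset (Fin m))
    (hF : ∀ e ∈ F, 2 ≤ ({i : Fin n | C i e ≠ 0}).ncard)
    (hdeg' : ∀ i,
      0 < hypDeg (C.submatrix id (fun e : {e : Fin m // e ∉ F} => (e : Fin m))) i)
    (t : ℕ) (ht : ∑ e ∈ F, ({i : Fin n | C i e ≠ 0}).ncard = t)
    (k : ℕ) (hk1 : 1 ≤ k) (hk2 : k ≤ n) (hk3 : t + 1 ≤ k + F.card) :
    sortedEig (hypNormLap C)
        ⟨k + F.card - t - 1, by
          have h2 : F.card • 2 ≤ ∑ e ∈ F, ({i : Fin n | C i e ≠ 0}).ncard :=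
            Finset.card_nsmul_le_sum F _ 2 hF
          rw [ht] at h2
          simp only [smul_eq_mul] at h2
          omega⟩ ≤
      sortedEig (hypNormLap (C.submatrix id (fun e : {e : Fin m // e ∉ F} => (e : Fin m))))
        ⟨k - 1, by omega⟩ := by
  set C' := C.submatrix id (fun e : {e : Fin m // e ∉ F} => (e : Fin m)) with hC'
  have h2 : F.card • 2 ≤ ∑ e ∈ F, ({i : Fin n | C i e ≠ 0}).ncard :=
    Finset.card_nsmul_le_sum F _ 2 hF
  rw [ht, smul_eq_mul] at h2
  obtain ⟨mono, V, hV, hA⟩ := spec_data _ (nl_herm C hdeg)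
  obtain ⟨mono', V', hV', hA'⟩ := spec_data _ (nl_herm C' hdeg')
  generalize hlam : sortedEig (hypNormLap C) = lam at *
  generalize hmu : sortedEig (hypNormLap C') = mu at *
  generalize_proofs p1 p2
  set a : Fin n := ⟨k + F.card - t - 1, p1⟩ with ha
  set b : Fin n := ⟨k - 1, p2⟩ with hb
  have hab : (a : ℕ) + F.card ≤ b := by simp only [ha, hb]; omega
  let s : Fin n → ℝ := fun i => Real.sqrt (hypDeg C i)
  let s' : Fin n → ℝ := fun i => Real.sqrt (hypDeg C' i)
  -- the linear constraints on `f`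
  let T1 : (Fin n → ℝ) →ₗ[ℝ] (Fin n → ℝ) := (V'ᵀ * Matrix.diagonal s').mulVecLin
  let T2 : (Fin n → ℝ) →ₗ[ℝ] (Fin n → ℝ) := (Vᵀ * Matrix.diagonal s).mulVecLin
  let T3 : (Fin n → ℝ) →ₗ[ℝ] (Fin m → ℝ) := Cᵀ.mulVecLin
  let T : (Fin n → ℝ) →ₗ[ℝ] (Finset.Ioi b → ℝ) × (Finset.Iio a → ℝ) × (F → ℝ) :=
    ((LinearMap.funLeft ℝ ℝ (fun i : Finset.Ioi b => (i : Fin n))).comp T1).prod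
      (((LinearMap.funLeft ℝ ℝ (fun i : Finset.Iio a => (i : Fin n))).comp T2).prod
      ((LinearMap.funLeft ℝ ℝ (fun i : F => (i : Fin m))).comp T3))
  have hker : LinearMap.ker T ≠ ⊥ := by
    apply LinearMap.ker_ne_bot_of_finrank_lt
    simp only [Module.finrank_prod, Module.finrank_fintype_fun_eq_card, Fintype.card_coe,
      Fin.card_Ioi, Fin.card_Iio, Fintype.card_fin]
    have := b.2
    omega
  obtain ⟨f, hf, hf0⟩ := Submodule.exists_mem_ne_zero_of_ne_bot hker
  rw [LinearMap.mem_ker] at hf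
  have c1 : ∀ i, b < i → (V'ᵀ *ᵥ fun i => s' i * f i) i = 0 := by
    intro i hi
    have := congrFun (congrArg Prod.fst hf) ⟨i, Finset.mem_Ioi.2 hi⟩
    have e : (fun i => s' i * f i) = Matrix.diagonal s' *ᵥ f := by
      ext i; rw [Matrix.mulVec_diagonal]
    rw [e, Matrix.mulVec_mulVec]
    exact this
  have c2 : ∀ i, i < a → (Vᵀ *ᵥ fun i => s i * f i) i = 0 := by
    intro i hi
    have := congrFun (congrArg (fun z => z.2.1) hf) ⟨i, Finset.mem_Iio.2 hi⟩
    have e : (fun i => s i * f i) = Matrix.diagonal s *ᵥ f := by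
      ext i; rw [Matrix.mulVec_diagonal]
    rw [e, Matrix.mulVec_mulVec]
    exact this
  have c3 : ∀ e ∈ F, ∑ i, C i e * f i = 0 := by
    intro e he
    exact congrFun (congrArg (fun z => z.2.2) hf) ⟨e, he⟩
  have q1 : ∑ e, (∑ i, C i e * f i) ^ 2 = ∑ e, (∑ i, C' i e * f i) ^ 2 := by
    have e1 : ∑ e, (∑ i, C' i e * f i) ^ 2 = ∑ e ∈ Fᶜ, (∑ i, C i e * f i) ^ 2 :=
      (Finset.sum_subtype Fᶜ (by simp) (fun e => (∑ i, C i e * f i) ^ 2)).symm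
    rw [e1]
    refine (Finset.sum_subset (Finset.subset_univ _) fun e _ he => ?_).symm
    rw [c3 e (by simpa using he)]
    simp
  have r := nl_quad C hdeg f
  have r' := nl_quad C' hdeg' f
  rw [hA, quad_diag] at r
  rw [hA', quad_diag] at r'
  have l1 : lam a * ∑ i, (s i * f i) ^ 2 ≤ ∑ e, (∑ i, C i e * f i) ^ 2 := by
    rw [← r, ← norm_diag V hV, Finset.mul_sum]
    refine Finset.sum_le_sum fun i _ => ?_
    rcases lt_or_ge i a with hi | hi
    · have := c2 i hi
      simp only [s] at this ⊢
      rw [this]; simp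
    · exact mul_le_mul_of_nonneg_right (mono hi) (sq_nonneg _)
  have l2 : ∑ e, (∑ i, C' i e * f i) ^ 2 ≤ mu b * ∑ i, (s' i * f i) ^ 2 := by
    rw [← r', ← norm_diag V' hV', Finset.mul_sum]
    refine Finset.sum_le_sum fun i _ => ?_
    rcases lt_or_ge b i with hi | hi
    · have := c1 i hi
      simp only [s'] at this ⊢
      rw [this]; simp
    · exact mul_le_mul_of_nonneg_right (mono' hi) (sq_nonneg _)
  obtain ⟨j, hj⟩ := Function.ne_iff.1 hf0
  have hj' : f j ≠ 0 := hj
  have pos' : 0 < ∑ i, (s' i * f i) ^ 2 := by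
    refine Finset.sum_pos' (fun i _ => sq_nonneg _) ⟨j, Finset.mem_univ _, ?_⟩
    have : 0 < s' j := Real.sqrt_pos.2 (hdeg' j)
    positivity
  have degle : ∀ i, hypDeg C' i ≤ hypDeg C i := by
    intro i
    have : hypDeg C' i = ∑ e ∈ Fᶜ, (C i e) ^ 2 :=
      (Finset.sum_subtype Fᶜ (by simp) (fun e => (C i e) ^ 2)).symm
    rw [this]
    exact Finset.sum_le_univ_sum_of_nonneg fun e => sq_nonneg _
  have nle : ∑ i, (s' i * f i) ^ 2 ≤ ∑ i, (s i * f i) ^ 2 := by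
    refine Finset.sum_le_sum fun i _ => ?_
    rw [mul_pow, mul_pow]
    refine mul_le_mul_of_nonneg_right ?_ (sq_nonneg _)
    exact pow_le_pow_left₀ (Real.sqrt_nonneg _) (Real.sqrt_le_sqrt (degle i)) 2
  have N0 : 0 ≤ ∑ e, (∑ i, C' i e * f i) ^ 2 := Finset.sum_nonneg fun e _ => sq_nonneg _
  have mu0 : 0 ≤ mu b := by
    by_contra hneg
    push Not at hneg
    have := mul_neg_of_neg_of_pos hneg pos'
    linarith
  have fin : lam a * ∑ i, (s i * f i) ^ 2 ≤ mu b * ∑ i, (s i * f i) ^ 2 := by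
    have := mul_le_mul_of_nonneg_left nle mu0
    linarith
  exact le_of_mul_le_mul_right fin (pos'.trans_le nle)
end

section
/- Let C be an n×m real matrix encoding a hypergraph with real coefficients G in which every vertex has positive degree, and let ℓ be a loop, i.e. an edge of cardinality 1 (exactly one index i satisfies C i ℓ ≠ 0); assume every vertex still has positive degree after column ℓ is deleted. Let L(G) be the normalized Laplacian of C and L(G∖ℓ) the normalized Laplacian of the matrix obtained from C by deleting column ℓ. Then for every k ∈ {1,…,n} with λ_k(L(G)) ≥ 1, one has λ_k(L(G∖ℓ)) ≥ λ_k(L(G)). -/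
open Matrix

lemma eig_expand {n : ℕ} {M : Matrix (Fin n) (Fin n) ℝ} (hM : M.IsHermitian) (x y : Fin n → ℝ) :
    ∑ j, ((hM.eigenvectorBasis j).ofLp ⬝ᵥ x) * ((hM.eigenvectorBasis j).ofLp ⬝ᵥ y) = x ⬝ᵥ y := by
  have h := hM.eigenvectorBasis.sum_inner_mul_inner (WithLp.toLp 2 x) (WithLp.toLp 2 y)
  simp only [EuclideanSpace.inner_eq_star_dotProduct, star_trivial] at h
  rw [dotProduct_comm x y, ← h]
  refine Finset.sum_congr rfl fun j _ => ?_
  rw [dotProduct_comm y]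

lemma eig_mul {n : ℕ} {M : Matrix (Fin n) (Fin n) ℝ} (hM : M.IsHermitian) (x : Fin n → ℝ)
    (j : Fin n) :
    (hM.eigenvectorBasis j).ofLp ⬝ᵥ (M *ᵥ x) =
      hM.eigenvalues j * ((hM.eigenvectorBasis j).ofLp ⬝ᵥ x) := by
  have hT : Mᵀ = M := by simpa using hM.eq
  rw [dotProduct_mulVec, ← mulVec_transpose, hT, hM.mulVec_eigenvectorBasis, smul_dotProduct,
    smul_eq_mul]

lemma eig_quad {n : ℕ} {M : Matrix (Fin n) (Fin n) ℝ} (hM : M.IsHermitian) (x : Fin n → ℝ) :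
    x ⬝ᵥ (M *ᵥ x) = ∑ j, hM.eigenvalues j * ((hM.eigenvectorBasis j).ofLp ⬝ᵥ x) ^ 2 := by
  rw [← eig_expand hM]
  refine Finset.sum_congr rfl fun j _ => ?_
  rw [eig_mul]; ring

lemma eig_norm {n : ℕ} {M : Matrix (Fin n) (Fin n) ℝ} (hM : M.IsHermitian) (x : Fin n → ℝ) :
    x ⬝ᵥ x = ∑ j, ((hM.eigenvectorBasis j).ofLp ⬝ᵥ x) ^ 2 := by
  rw [← eig_expand hM]
  refine Finset.sum_congr rfl fun j _ => ?_
  ring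

lemma sorted_eq {n : ℕ} {M : Matrix (Fin n) (Fin n) ℝ} (hM : M.IsHermitian) (k : Fin n) :
    sortedEig M k = hM.eigenvalues (Tuple.sort hM.eigenvalues k) := by
  rw [sortedEig, dif_pos hM]
  rfl

lemma sorted_mono {n : ℕ} {M : Matrix (Fin n) (Fin n) ℝ} (hM : M.IsHermitian) {j k : Fin n}
    (h : j ≤ k) : sortedEig M j ≤ sortedEig M k := by
  rw [sorted_eq hM, sorted_eq hM]
  exact Tuple.monotone_sort hM.eigenvalues h

lemma exists_test {n : ℕ} {M N : Matrix (Fin n) (Fin n) ℝ} (hM : M.IsHermitian)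
    (hN : N.IsHermitian) (s : Fin n → ℝ) (k : Fin n) :
    ∃ x : Fin n → ℝ, x ≠ 0 ∧ sortedEig M k * (x ⬝ᵥ x) ≤ x ⬝ᵥ (M *ᵥ x) ∧
      (s * x) ⬝ᵥ (N *ᵥ (s * x)) ≤ sortedEig N k * ((s * x) ⬝ᵥ (s * x)) := by
  let f : (Fin n → ℝ) →ₗ[ℝ] ({j : Fin n // j ≠ k} → ℝ) :=
    { toFun := fun x j => if j.1 < k then
        (hM.eigenvectorBasis (Tuple.sort hM.eigenvalues j)).ofLp ⬝ᵥ x else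
        (hN.eigenvectorBasis (Tuple.sort hN.eigenvalues j)).ofLp ⬝ᵥ (s * x)
      map_add' := by
        intro x y; ext j
        simp only [mul_add, dotProduct_add, Pi.add_apply]
        split_ifs <;> rfl
      map_smul' := by
        intro c x; ext j
        simp only [mul_smul_comm, dotProduct_smul, Pi.smul_apply, RingHom.id_apply]
        split_ifs <;> rfl }
  have hlt : Module.finrank ℝ ({j : Fin n // j ≠ k} → ℝ) < Module.finrank ℝ (Fin n → ℝ) := by
    rw [Module.finrank_pi, Module.finrank_pi]
    exact Fintype.card_subtype_lt (x := k) (by simp)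
  obtain ⟨x, hx, hx0⟩ := (Submodule.ne_bot_iff _).1 (LinearMap.ker_ne_bot_of_finrank_lt (f := f) hlt)
  have hfx : ∀ j : {j : Fin n // j ≠ k}, (if j.1 < k then
        (hM.eigenvectorBasis (Tuple.sort hM.eigenvalues j)).ofLp ⬝ᵥ x else
        (hN.eigenvectorBasis (Tuple.sort hN.eigenvalues j)).ofLp ⬝ᵥ (s * x)) = 0 :=
    fun j => congrFun hx j
  refine ⟨x, hx0, ?_, ?_⟩
  · rw [eig_quad hM, eig_norm hM, Finset.mul_sum, ← Equiv.sum_comp (Tuple.sort hM.eigenvalues),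
      ← Equiv.sum_comp (Tuple.sort hM.eigenvalues)
        (fun j => hM.eigenvalues j * ((hM.eigenvectorBasis j).ofLp ⬝ᵥ x) ^ 2)]
    refine Finset.sum_le_sum fun j _ => ?_
    rw [← sorted_eq hM]
    rcases lt_or_ge j k with h | h
    · have := hfx ⟨j, h.ne⟩
      rw [if_pos h] at this
      simp [this]
    · exact mul_le_mul_of_nonneg_right (sorted_mono hM h) (sq_nonneg _)
  · rw [eig_quad hN, eig_norm hN, Finset.mul_sum, ← Equiv.sum_comp (Tuple.sort hN.eigenvalues),
      ← Equiv.sum_comp (Tuple.sort hN.eigenvalues)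
        (fun j => sortedEig N k * ((hN.eigenvectorBasis j).ofLp ⬝ᵥ (s * x)) ^ 2)]
    refine Finset.sum_le_sum fun j _ => ?_
    rw [← sorted_eq hN]
    rcases le_or_gt j k with h | h
    · exact mul_le_mul_of_nonneg_right (sorted_mono hN h) (sq_nonneg _)
    · have := hfx ⟨j, h.ne'⟩
      rw [if_neg h.not_gt] at this
      simp [this]

lemma normLap_herm {n : ℕ} {E : Type*} [Fintype E] (C : Matrix (Fin n) E ℝ) :
    (hypNormLap C).IsHermitian := by
  ext i j
  simp only [hypNormLap, hypAdj, conjTranspose_apply, Matrix.sub_apply, mul_diagonal, diagonal_mul,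
    of_apply, star_trivial, one_apply, eq_comm (a := j) (b := i), mul_comm (C j _)]
  ring

lemma normLap_quad {n : ℕ} {E : Type*} [Fintype E] (C : Matrix (Fin n) E ℝ)
    (hdeg : ∀ i, 0 < hypDeg C i) (y : Fin n → ℝ) :
    ((fun i => √(hypDeg C i)) * y) ⬝ᵥ (hypNormLap C *ᵥ ((fun i => √(hypDeg C i)) * y)) =
      ((fun i => √(hypDeg C i)) * y) ⬝ᵥ ((fun i => √(hypDeg C i)) * y) -
        y ⬝ᵥ (hypAdj C *ᵥ y) := by
  have h1 : diagonal (fun i => (√(hypDeg C i))⁻¹) *ᵥ ((fun i => √(hypDeg C i)) * y) = y := by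
    ext i
    have := (Real.sqrt_pos.2 (hdeg i)).ne'
    simp [mulVec_diagonal, this]
  rw [hypNormLap, sub_mulVec, one_mulVec, dotProduct_sub, ← mulVec_mulVec, h1, ← mulVec_mulVec,
    dotProduct_mulVec _ (diagonal _), ← mulVec_transpose, diagonal_transpose, h1]

/-- Removing a loop `ℓ` does not decrease the eigenvalues of the normalized Laplacian
that are `≥ 1`. -/
theorem normLap_loop_deletion_ge {n m : ℕ} (C : Matrix (Fin n) (Fin m) ℝ)
    (ℓ : Fin m) (hloop : ({i : Fin n | C i ℓ ≠ 0}).ncard = 1)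
    (hdeg : ∀ i, 0 < hypDeg C i)
    (hdeg' : ∀ i,
      0 < hypDeg (C.submatrix id (fun e : {e : Fin m // e ≠ ℓ} => (e : Fin m))) i)
    (k : Fin n) (hk : 1 ≤ sortedEig (hypNormLap C) k) :
    sortedEig (hypNormLap C) k ≤
      sortedEig (hypNormLap (C.submatrix id (fun e : {e : Fin m // e ≠ ℓ} => (e : Fin m))))
        k := by
  have hsum : ∀ g : Fin m → ℝ, ∑ e, g e = g ℓ + ∑ e : {e : Fin m // e ≠ ℓ}, g e := by
    intro g
    exact Fintype.sum_eq_add_sum_subtype_ne g ℓ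
  set C' := C.submatrix id (fun e : {e : Fin m // e ≠ ℓ} => (e : Fin m)) with hC'
  have hA : hypAdj C' = hypAdj C := by
    ext i j
    simp only [hypAdj, of_apply]
    split_ifs with hij
    · rfl
    · rw [hsum]
      have : C i ℓ * C j ℓ = 0 := by
        by_contra hne
        obtain ⟨a, ha⟩ := Set.ncard_eq_one.1 hloop
        have h1 : i ∈ ({a} : Set (Fin n)) := ha ▸ left_ne_zero_of_mul hne
        have h2 : j ∈ ({a} : Set (Fin n)) := ha ▸ right_ne_zero_of_mul hne
        exact hij (h1.trans h2.symm)
      rw [this, zero_add]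
      rfl
  have hD : ∀ i, hypDeg C' i ≤ hypDeg C i := by
    intro i
    simp only [hypDeg]
    rw [hsum]
    exact le_add_of_nonneg_left (sq_nonneg _)
  obtain ⟨x, hx0, h1, h2⟩ := exists_test (normLap_herm C) (normLap_herm C')
    (fun i => √(hypDeg C' i) / √(hypDeg C i)) k
  set y : Fin n → ℝ := fun i => x i / √(hypDeg C i) with hy
  have e1 : x = (fun i => √(hypDeg C i)) * y := by
    ext i
    have := (Real.sqrt_pos.2 (hdeg i)).ne'
    simp only [hy, Pi.mul_apply]; field_simp
  have e2 : (fun i => √(hypDeg C' i) / √(hypDeg C i)) * x = (fun i => √(hypDeg C' i)) * y := by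
    ext i
    simp only [hy, Pi.mul_apply]; ring
  have hy0 : y ≠ 0 := by
    intro h
    rw [h, mul_zero] at e1
    exact hx0 e1
  rw [e1, normLap_quad C hdeg] at h1
  rw [e2, normLap_quad C' hdeg', hA] at h2
  have hn : ((fun i => √(hypDeg C' i)) * y) ⬝ᵥ ((fun i => √(hypDeg C' i)) * y) ≤
      ((fun i => √(hypDeg C i)) * y) ⬝ᵥ ((fun i => √(hypDeg C i)) * y) := by
    refine Finset.sum_le_sum fun i _ => ?_
    have a := Real.mul_self_sqrt (hdeg i).le
    have b := Real.mul_self_sqrt (hdeg' i).le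
    simp only [Pi.mul_apply]
    rw [mul_mul_mul_comm, b, mul_mul_mul_comm, a]
    exact mul_le_mul_of_nonneg_right (hD i) (mul_self_nonneg _)
  have hp : 0 < ((fun i => √(hypDeg C' i)) * y) ⬝ᵥ ((fun i => √(hypDeg C' i)) * y) := by
    obtain ⟨i, hi⟩ := Function.ne_iff.1 hy0
    refine Finset.sum_pos' (fun i _ => mul_self_nonneg _) ⟨i, Finset.mem_univ _, ?_⟩
    exact mul_self_pos.2 (mul_ne_zero (Real.sqrt_pos.2 (hdeg' i)).ne' hi)
  generalize ((fun i => √(hypDeg C' i)) * y) ⬝ᵥ ((fun i => √(hypDeg C' i)) * y) = p at *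
  generalize ((fun i => √(hypDeg C i)) * y) ⬝ᵥ ((fun i => √(hypDeg C i)) * y) = q at *
  by_contra hlt
  push Not at hlt
  nlinarith [mul_pos (sub_pos.2 hlt) hp, mul_nonneg (sub_nonneg.2 hk) (sub_nonneg.2 hn)]
end
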